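/- arXiv:2101.07087 — 3 statements merged into one kernel-verified Lean document; each statement's English description precedes it below -/
import Mathlib

section
/- Let L, ℓ, ℓ' be positive integers, let (u_i)_{i=1}^{ℓ} and (v_j)_{j=1}^{ℓ'} each be orthonormal families in Euclidean space ℝ^L, and let γ_L be the standard Gaussian product measure on ℝ^L. Let a ∈ ℤ₊^ℓ and a' ∈ ℤ₊^{ℓ'} be multi-indices. If |a| = |a'| = m, then ∫ (Π_{i=1}^{ℓ} Ĥ_{a_i}(⟨u_i, x⟩)) · (Π_{j=1}^{ℓ'} Ĥ_{a'_j}(⟨v_j, x⟩)) dγ_L(x) = (1/√(a! · a'!)) · Σ_{σ ∈ S_m} Π_{n=1}^{m} ⟨u_{η_a(n)}, v_{η_{a'}(σ(n))}⟩; and if |a| ≠ |a'| the integral is 0. -/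
open MeasureTheory ProbabilityTheory Finset

/-- The normalized (probabilists') Hermite polynomial `Ĥ_m = He_m / √(m!)`. -/
noncomputable def normalizedHermite (m : ℕ) (x : ℝ) : ℝ :=
  (Polynomial.aeval x (Polynomial.hermite m)) / Real.sqrt (Nat.factorial m)

/-- `η` is the function `η_a : {1,…,m} → {1,…,ℓ}` of the paper (written 0-indexed), i.e.
`η_a(n) = i` whenever `Σ_{k<i} a_k ≤ n < Σ_{k≤i} a_k`. -/
def IsEta {ℓ m : ℕ} (a : Fin ℓ → ℕ) (η : Fin m → Fin ℓ) : Prop :=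
  ∀ n : Fin m,
    (∑ k ∈ Finset.univ.filter (fun k : Fin ℓ => k < η n), a k) ≤ (n : ℕ) ∧
    (n : ℕ) < ∑ k ∈ Finset.univ.filter (fun k : Fin ℓ => k ≤ η n), a k

open MvPolynomial in
/-- The linear form `⟨w, x⟩` as a polynomial in the coordinates of `x`. -/
noncomputable def linearFormPoly {ι : Type*} [Fintype ι] (w : ι → ℝ) : MvPolynomial ι ℝ :=
  ∑ k, C (w k) * X k

open MvPolynomial in
/-- The directional derivative `∂_w` on polynomials. -/
noncomputable def dirDeriv {ι : Type*} [Fintype ι] (w : ι → ℝ) :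
    Derivation ℝ (MvPolynomial ι ℝ) (MvPolynomial ι ℝ) :=
  mkDerivation ℝ fun k => C (w k)

/-- The Wick product `:⟨w₁, x⟩ ⋯ ⟨w_n, x⟩:`, obtained by applying to `1` the creation operators
`p ↦ ⟨w, x⟩ p - ∂_w p`. -/
noncomputable def wickProduct {ι : Type*} [Fintype ι] :
    {n : ℕ} → (Fin n → ι → ℝ) → MvPolynomial ι ℝ
  | 0, _ => 1
  | _ + 1, w => linearFormPoly (w 0) * wickProduct (Fin.tail w) -
      dirDeriv (w 0) (wickProduct (Fin.tail w))

section WickProduct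

open MvPolynomial

variable {ι : Type*} [Fintype ι]

lemma dirDeriv_apply (w : ι → ℝ) (p : MvPolynomial ι ℝ) :
    dirDeriv w p = ∑ k, C (w k) * pderiv k p := by
  classical
  have happ (D : ι → Derivation ℝ (MvPolynomial ι ℝ) (MvPolynomial ι ℝ)) (q : MvPolynomial ι ℝ) :
      (∑ k, D k) q = ∑ k, D k q := by
    rw [← Derivation.coeFnAddMonoidHom_apply, map_sum]
    simp
  have h : dirDeriv w = ∑ k, (C (w k) : MvPolynomial ι ℝ) • pderiv k := by
    refine MvPolynomial.derivation_ext fun i => ?_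
    simp [happ, dirDeriv, mkDerivation_X, pderiv_X, Pi.single_apply]
  simp [h, happ]

lemma dirDeriv_linearFormPoly (w z : ι → ℝ) :
    dirDeriv w (linearFormPoly z) = C (∑ k, w k * z k) := by
  simp [dirDeriv, linearFormPoly, mkDerivation_X, mul_comm]

lemma dirDeriv_comm (w z : ι → ℝ) (p : MvPolynomial ι ℝ) :
    dirDeriv w (dirDeriv z p) = dirDeriv z (dirDeriv w p) := by
  have h : ⁅dirDeriv w, dirDeriv z⁆ = 0 := by
    refine MvPolynomial.derivation_ext fun i => ?_
    simp [Derivation.commutator_apply, dirDeriv, mkDerivation_X]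
  have := congrArg (fun D => D p) h
  simpa [Derivation.commutator_apply, sub_eq_zero] using this

lemma dirDeriv_wickProduct {n : ℕ} (w : ι → ℝ) (z : Fin (n + 1) → ι → ℝ) :
    dirDeriv w (wickProduct z) =
      ∑ j, C (∑ k, w k * z j k) * wickProduct (fun i => z (j.succAbove i)) := by
  induction n with
  | zero =>
    simp [wickProduct, dirDeriv_linearFormPoly]
  | succ n ih =>
    rw [Fin.sum_univ_succ]
    have key : ∀ j : Fin (n + 1), wickProduct (fun i => z (j.succ.succAbove i)) =
        linearFormPoly (z 0) * wickProduct (fun i => Fin.tail z (j.succAbove i)) -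
          dirDeriv (z 0) (wickProduct (fun i => Fin.tail z (j.succAbove i))) := by
      intro j
      rw [wickProduct]
      simp [Fin.tail_def]
    simp_rw [key]
    rw [wickProduct, map_sub, Derivation.leibniz, dirDeriv_comm w (z 0), ih,
      dirDeriv_linearFormPoly]
    simp only [← smul_eq_C_mul, smul_eq_mul, Fin.zero_succAbove, Fin.tail_def]
    rw [mul_comm (wickProduct _) (C _), ← smul_eq_C_mul]
    simp only [map_sum, Derivation.map_smul, smul_sub, Finset.sum_sub_distrib, Finset.mul_sum,
      mul_smul_comm]
    ring

end WickProduct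

section GaussianExpectation

open MvPolynomial

lemma integrable_pow_gaussianReal (n : ℕ) :
    Integrable (fun x : ℝ => x ^ n) (gaussianReal 0 1) :=
  (memLp_id_gaussianReal (μ := 0) (v := 1) n).integrable_norm_pow' |>.mono
    (by fun_prop) (ae_of_all _ fun x => by simp)

lemma integral_pow_succ_gaussianReal (n : ℕ) :
    ∫ x, x ^ (n + 1) ∂(gaussianReal 0 1) = n * ∫ x, x ^ (n - 1) ∂(gaussianReal 0 1) := by
  have hint (k : ℕ) : Integrable (fun x : ℝ => x ^ k * gaussianPDFReal 0 1 x) := by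
    have h := integrable_pow_gaussianReal k
    rw [gaussianReal_of_var_ne_zero _ one_ne_zero, integrable_withDensity_iff
      (measurable_gaussianPDF 0 1) (ae_of_all _ fun _ => gaussianPDF_lt_top)] at h
    simpa [toReal_gaussianPDF] using h
  have hderiv (x : ℝ) : HasDerivAt (gaussianPDFReal 0 1) (-x * gaussianPDFReal 0 1 x) x := by
    rw [gaussianPDFReal_def]
    have h : HasDerivAt (fun y : ℝ => -(y - 0) ^ 2 / (2 * ((1 : NNReal) : ℝ))) (-x) x := by
      have := ((((hasDerivAt_id x).sub_const 0).pow 2).neg).div_const (2 * ((1 : NNReal) : ℝ))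
      refine this.congr_deriv ?_
      simp only [NNReal.coe_one, id]
      ring
    refine (h.exp.const_mul _).congr_deriv ?_
    ring
  have hparts := integral_mul_deriv_eq_deriv_mul_of_integrable
    (u := fun x : ℝ => x ^ n) (u' := fun x : ℝ => n * x ^ (n - 1))
    (v := gaussianPDFReal 0 1) (v' := fun x => -x * gaussianPDFReal 0 1 x)
    (fun x _ => hasDerivAt_pow n x) (fun x _ => hderiv x)
    ((hint (n + 1)).neg.congr (ae_of_all _ fun x => by simp; ring))
    (((hint (n - 1)).const_mul (n : ℝ)).congr (ae_of_all _ fun x => by simp; ring))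
    (hint n)
  simp only [integral_gaussianReal_eq_integral_smul one_ne_zero, smul_eq_mul]
  rw [← integral_const_mul, ← neg_inj, ← integral_neg]
  calc _ = ∫ x : ℝ, x ^ n * (-x * gaussianPDFReal 0 1 x) := by congr 1; ext x; ring
    _ = _ := by rw [hparts]; congr 2; ext x; ring

variable {ι : Type*} [Fintype ι]

lemma eval_monomial_eq_mul_prod (s : ι →₀ ℕ) (c : ℝ) (x : ι → ℝ) :
    eval x (monomial s c) = c * ∏ i, x i ^ s i := by
  rw [eval_monomial, Finsupp.prod_fintype _ _ (by simp)]

lemma integrable_eval_gaussian (p : MvPolynomial ι ℝ) :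
    Integrable (fun x => eval x p) (Measure.pi fun _ : ι => gaussianReal 0 1) := by
  induction p using MvPolynomial.induction_on' with
  | monomial s c =>
    simp_rw [eval_monomial_eq_mul_prod]
    exact (Integrable.fintype_prod fun i => integrable_pow_gaussianReal (s i)).const_mul c
  | add p q hp hq =>
    simp_rw [map_add]
    exact hp.add hq

/-- Expectation of a polynomial under the standard Gaussian product measure. -/
noncomputable def gaussianExpectation (ι : Type*) [Fintype ι] : MvPolynomial ι ℝ →ₗ[ℝ] ℝ where
  toFun p := ∫ x, eval x p ∂(Measure.pi fun _ : ι => gaussianReal 0 1)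
  map_add' p q := by
    simp_rw [map_add]
    exact integral_add (integrable_eval_gaussian p) (integrable_eval_gaussian q)
  map_smul' c p := by
    simp_rw [smul_eval]
    exact integral_const_mul c _

lemma gaussianExpectation_apply (p : MvPolynomial ι ℝ) :
    gaussianExpectation ι p = ∫ x, eval x p ∂(Measure.pi fun _ : ι => gaussianReal 0 1) := rfl

lemma gaussianExpectation_monomial (s : ι →₀ ℕ) (c : ℝ) :
    gaussianExpectation ι (monomial s c) =
      c * ∏ i, ∫ x, x ^ s i ∂(gaussianReal 0 1) := by
  simp_rw [gaussianExpectation_apply, eval_monomial_eq_mul_prod]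
  rw [integral_const_mul, integral_fintype_prod_eq_prod (fun i (y : ℝ) => y ^ s i)]

lemma gaussianExpectation_one : gaussianExpectation ι 1 = 1 := by
  simp [gaussianExpectation_apply]

lemma gaussianExpectation_X_mul (k : ι) (p : MvPolynomial ι ℝ) :
    gaussianExpectation ι (X k * p) = gaussianExpectation ι (pderiv k p) := by
  classical
  induction p using MvPolynomial.induction_on' with
  | monomial s c =>
    rw [X, monomial_mul, pderiv_monomial, gaussianExpectation_monomial,
      gaussianExpectation_monomial, ← Finset.mul_prod_erase _ _ (Finset.mem_univ k),
      ← Finset.mul_prod_erase _ (fun i => ∫ x, x ^ (s - Finsupp.single k 1 : ι →₀ ℕ) i ∂(gaussianReal 0 1))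
        (Finset.mem_univ k)]
    have h : ∀ i ∈ Finset.univ.erase k,
        ∫ x, x ^ (Finsupp.single k 1 + s : ι →₀ ℕ) i ∂(gaussianReal 0 1) =
        ∫ x, x ^ (s - Finsupp.single k 1 : ι →₀ ℕ) i ∂(gaussianReal 0 1) := by
      intro i hi
      simp [Finsupp.single_eq_of_ne (Finset.ne_of_mem_erase hi)]
    rw [Finset.prod_congr rfl h]
    simp only [Finsupp.coe_add, Pi.add_apply, Finsupp.coe_tsub, Pi.sub_apply,
      Finsupp.single_eq_same]
    rw [add_comm 1 (s k), integral_pow_succ_gaussianReal]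
    ring
  | add p q hp hq => simp [mul_add, hp, hq]

lemma gaussianExpectation_linearFormPoly_mul (w : ι → ℝ) (p : MvPolynomial ι ℝ) :
    gaussianExpectation ι (linearFormPoly w * p) = gaussianExpectation ι (dirDeriv w p) := by
  simp [linearFormPoly, dirDeriv_apply, Finset.sum_mul, ← smul_eq_C_mul,
    gaussianExpectation_X_mul]

/-- The creation operator is adjoint to the directional derivative. -/
lemma gaussianExpectation_creation_mul (w : ι → ℝ) (p q : MvPolynomial ι ℝ) :
    gaussianExpectation ι ((linearFormPoly w * p - dirDeriv w p) * q) =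
      gaussianExpectation ι (p * dirDeriv w q) := by
  rw [sub_mul, map_sub, mul_assoc, gaussianExpectation_linearFormPoly_mul, Derivation.leibniz,
    ← map_sub]
  congr 1
  simp only [smul_eq_mul]
  ring

lemma gaussianExpectation_wickProduct_mul_succ {m n : ℕ} (w : Fin (m + 1) → ι → ℝ)
    (z : Fin (n + 1) → ι → ℝ) :
    gaussianExpectation ι (wickProduct w * wickProduct z) =
      ∑ j, (∑ k, w 0 k * z j k) *
        gaussianExpectation ι (wickProduct (Fin.tail w) *
          wickProduct (fun i => z (j.succAbove i))) := by
  rw [wickProduct, gaussianExpectation_creation_mul, dirDeriv_wickProduct, Finset.mul_sum, map_sum]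
  simp_rw [← smul_eq_C_mul, mul_smul_comm, map_smul, smul_eq_mul]

lemma gaussianExpectation_wickProduct_mul_of_ne {m n : ℕ} (hmn : m ≠ n) (w : Fin m → ι → ℝ)
    (z : Fin n → ι → ℝ) : gaussianExpectation ι (wickProduct w * wickProduct z) = 0 := by
  induction m generalizing n with
  | zero =>
    cases n with
    | zero => exact absurd rfl hmn
    | succ n =>
      rw [mul_comm, wickProduct.eq_2, gaussianExpectation_creation_mul]
      simp [wickProduct]
  | succ m ih =>
    cases n with
    | zero =>
      rw [wickProduct.eq_2, gaussianExpectation_creation_mul]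
      simp [wickProduct]
    | succ n =>
      rw [gaussianExpectation_wickProduct_mul_succ]
      simp [ih (n := n) (by omega)]

lemma sum_perm_prod_succ {R : Type*} [CommSemiring R] {n : ℕ}
    (f : Fin (n + 1) → Fin (n + 1) → R) :
    ∑ σ : Equiv.Perm (Fin (n + 1)), ∏ i, f i (σ i) =
      ∑ j, f 0 j * ∑ τ : Equiv.Perm (Fin n), ∏ i : Fin n, f i.succ (j.succAbove (τ i)) := by
  rw [← Equiv.Perm.decomposeFin.symm.sum_comp, Fintype.sum_prod_type]
  refine Finset.sum_congr rfl fun j _ => ?_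
  rw [Finset.mul_sum]
  simp only [Fin.prod_univ_succ, Equiv.Perm.decomposeFin_symm_apply_zero,
    Equiv.Perm.decomposeFin_symm_apply_succ]
  refine Fin.cases (by simp) (fun j => ?_) j
  simp_rw [← Fin.succAbove_cycleRange]
  exact Fintype.sum_equiv (Equiv.mulLeft j.cycleRange) _ _ fun τ => rfl

lemma gaussianExpectation_wickProduct_mul {n : ℕ} (w z : Fin n → ι → ℝ) :
    gaussianExpectation ι (wickProduct w * wickProduct z) =
      ∑ σ : Equiv.Perm (Fin n), ∏ i, ∑ k, w i k * z (σ i) k := by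
  induction n with
  | zero => simp [wickProduct, gaussianExpectation_one]
  | succ n ih =>
    rw [gaussianExpectation_wickProduct_mul_succ,
      sum_perm_prod_succ fun i j => ∑ k, w i k * z j k]
    simp_rw [ih, Fin.tail_def]

end GaussianExpectation

section Hermite

open MvPolynomial

variable {ι κ : Type*} [Fintype ι] [Fintype κ] [DecidableEq κ]

lemma dirDeriv_aeval_linearFormPoly (w z : ι → ℝ) (p : Polynomial ℤ) :
    dirDeriv w (Polynomial.aeval (linearFormPoly z) p) =
      C (∑ k, w k * z k) * Polynomial.aeval (linearFormPoly z) (Polynomial.derivative p) := by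
  induction p using Polynomial.induction_on' with
  | add p q hp hq => simp [hp, hq, mul_add]
  | monomial n c =>
    simp [Polynomial.derivative_monomial, Polynomial.aeval_monomial, Derivation.leibniz_pow,
      dirDeriv_linearFormPoly, Derivation.leibniz]
    ring

/-- Wick products of vectors taken from an orthonormal family are products of Hermite
polynomials. -/
lemma wickProduct_comp_eq_prod_hermite (u : κ → ι → ℝ)
    (hu : ∀ i i' : κ, ∑ k, u i k * u i' k = if i = i' then 1 else 0) {n : ℕ} (η : Fin n → κ) :
    wickProduct (fun t => u (η t)) =
      ∏ i, Polynomial.aeval (linearFormPoly (u i))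
        (Polynomial.hermite (#{t | η t = i})) := by
  induction n with
  | zero => simp [wickProduct]
  | succ n ih =>
    have hcard (i : κ) : #{t | η t = i} =
        (if η 0 = i then 1 else 0) + #{t : Fin n | η t.succ = i} := by
      simp only [Finset.card_filter, Fin.sum_univ_succ]
    have htail : Fin.tail (fun t => u (η t)) = fun t : Fin n => u (η t.succ) := rfl
    rw [wickProduct, htail, ih fun t => η t.succ,
      ← Finset.mul_prod_erase _ _ (Finset.mem_univ (η 0)),
      ← Finset.mul_prod_erase _ _ (Finset.mem_univ (η 0)), hcard, if_pos rfl, add_comm 1,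
      Polynomial.hermite_succ]
    have hrest : ∀ i ∈ Finset.univ.erase (η 0),
        Polynomial.aeval (linearFormPoly (u i)) (Polynomial.hermite #{t | η t = i}) =
        Polynomial.aeval (linearFormPoly (u i))
          (Polynomial.hermite #{t : Fin n | η t.succ = i}) := by
      intro i hi
      rw [hcard, if_neg (Finset.ne_of_mem_erase hi).symm, zero_add]
    have hzero : dirDeriv (u (η 0)) (∏ i ∈ Finset.univ.erase (η 0),
        Polynomial.aeval (linearFormPoly (u i))
          (Polynomial.hermite #{t : Fin n | η t.succ = i})) = 0 := by
      refine Finset.prod_induction _ (fun p => dirDeriv (u (η 0)) p = 0)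
        (fun p q hp hq => by simp [Derivation.leibniz, hp, hq]) (by simp) fun i hi => ?_
      rw [dirDeriv_aeval_linearFormPoly, hu, if_neg (Finset.ne_of_mem_erase hi).symm]
      simp
    rw [Finset.prod_congr rfl hrest, Derivation.leibniz, hzero, dirDeriv_aeval_linearFormPoly, hu]
    simp only [if_pos, map_one, map_sub, map_mul, Polynomial.aeval_X, smul_eq_mul]
    ring

lemma eval_linearFormPoly (w x : ι → ℝ) : eval x (linearFormPoly w) = ∑ k, w k * x k := by
  simp [linearFormPoly]

lemma prod_normalizedHermite_eq_eval_wickProduct (u : κ → ι → ℝ)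
    (hu : ∀ i i' : κ, ∑ k, u i k * u i' k = if i = i' then 1 else 0) {n : ℕ} (η : Fin n → κ)
    (a : κ → ℕ) (ha : ∀ i, #{t | η t = i} = a i) (x : ι → ℝ) :
    ∏ i, normalizedHermite (a i) (∑ k, u i k * x k) =
      (1 / Real.sqrt (∏ i, Nat.factorial (a i))) * eval x (wickProduct fun t => u (η t)) := by
  have haeval (i : κ) (p : Polynomial ℤ) :
      eval x (Polynomial.aeval (linearFormPoly (u i)) p) =
        Polynomial.aeval (∑ k, u i k * x k) p := by
    rw [← eval_linearFormPoly]
    exact (Polynomial.aeval_algHom_apply (eval x).toIntAlgHom _ p).symm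
  rw [wickProduct_comp_eq_prod_hermite u hu η, map_prod]
  simp_rw [haeval, ha, normalizedHermite, Finset.prod_div_distrib]
  rw [← Real.sqrt_prod _ fun _ _ => Nat.cast_nonneg _]
  ring

lemma integral_prod_normalizedHermite_mul {κ' : Type*} [Fintype κ'] [DecidableEq κ']
    (u : κ → ι → ℝ) (v : κ' → ι → ℝ)
    (hu : ∀ i i' : κ, ∑ k, u i k * u i' k = if i = i' then 1 else 0)
    (hv : ∀ j j' : κ', ∑ k, v j k * v j' k = if j = j' then 1 else 0)
    {m n : ℕ} (η : Fin m → κ) (η' : Fin n → κ') (a : κ → ℕ) (a' : κ' → ℕ)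
    (ha : ∀ i, #{t | η t = i} = a i) (ha' : ∀ j, #{t | η' t = j} = a' j) :
    ∫ x : ι → ℝ, (∏ i, normalizedHermite (a i) (∑ k, u i k * x k)) *
        (∏ j, normalizedHermite (a' j) (∑ k, v j k * x k))
        ∂(Measure.pi fun _ : ι => gaussianReal 0 1) =
      (1 / Real.sqrt ((∏ i, Nat.factorial (a i)) * (∏ j, Nat.factorial (a' j)))) *
        gaussianExpectation ι
          (wickProduct (fun t => u (η t)) * wickProduct (fun t => v (η' t))) := by
  simp_rw [prod_normalizedHermite_eq_eval_wickProduct u hu η a ha,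
    prod_normalizedHermite_eq_eval_wickProduct v hv η' a' ha']
  rw [gaussianExpectation_apply, ← integral_const_mul, Real.sqrt_mul (by positivity)]
  congr 1
  ext x
  push_cast [map_mul]
  ring

end Hermite

lemma IsEta.card_fiber_eq {ℓ m : ℕ} {a : Fin ℓ → ℕ} {η : Fin m → Fin ℓ} (hη : IsEta a η)
    (ha : ∑ i, a i = m) (i : Fin ℓ) : #{t | η t = i} = a i := by
  have hle (i : Fin ℓ) : #{t | η t = i} ≤ a i := by
    have hsum : ∑ k with k ≤ i, a k = a i + ∑ k with k < i, a k := by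
      rw [← Finset.sum_insert (by simp)]
      congr 1
      ext k
      simp [le_iff_eq_or_lt]
    calc #{t | η t = i} = #((Finset.univ.filter fun t => η t = i).image Fin.val) :=
          (Finset.card_image_of_injective _ Fin.val_injective).symm
      _ ≤ #(Finset.Ico (∑ k with k < i, a k) (∑ k with k ≤ i, a k)) := by
          refine Finset.card_le_card fun n hn => ?_
          simp only [Finset.mem_image, Finset.mem_filter, Finset.mem_univ, true_and] at hn
          obtain ⟨t, rfl, rfl⟩ := hn
          exact Finset.mem_Ico.2 (hη t)
      _ = a i := by rw [Nat.card_Ico, hsum, Nat.add_sub_cancel]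
  have hcard : ∑ i, #{t | η t = i} = ∑ i, a i := by
    rw [ha, ← Finset.card_eq_sum_card_fiberwise (fun _ _ => Finset.mem_univ _),
      Finset.card_univ, Fintype.card_fin]
  exact (Finset.sum_eq_sum_iff_of_le fun i _ => hle i).1 hcard i (Finset.mem_univ i)

lemma exists_card_fiber_eq {ℓ : ℕ} (b : Fin ℓ → ℕ) :
    ∃ η : Fin (∑ i, b i) → Fin ℓ, ∀ i, #{t | η t = i} = b i := by
  refine ⟨fun t => (finSigmaFinEquiv.symm t).1, fun i => ?_⟩
  rw [← Fintype.card_subtype]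
  trans Fintype.card (Fin (b i))
  · exact Fintype.card_congr ((finSigmaFinEquiv.symm.subtypeEquiv fun _ => Iff.rfl).trans
      (Equiv.sigmaSubtype i))
  · exact Fintype.card_fin _

/-- For orthonormal families `(u_i)_{i=1}^ℓ`, `(v_j)_{j=1}^{ℓ'}` in `ℝ^L`
and multi-indices with `|a| = |a'| = m`,
`∫ (Π_i Ĥ_{a_i}(⟨u_i,x⟩)) (Π_j Ĥ_{a'_j}(⟨v_j,x⟩)) dγ_L
  = (1/√(a!·a'!)) Σ_{σ ∈ S_m} Π_n ⟨u_{η_a(n)}, v_{η_{a'}(σ(n))}⟩`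
(the Hilbert–Schmidt inner product of the symmetric forms), and the integral vanishes
when `|a| ≠ |a'|`. -/
theorem gaussian_integral_hermite_products_eq_hilbertSchmidt (L ℓ ℓ' m : ℕ)
    (hL : 0 < L) (hℓ : 0 < ℓ) (hℓ' : 0 < ℓ')
    (u : Fin ℓ → Fin L → ℝ) (v : Fin ℓ' → Fin L → ℝ)
    (hu : ∀ i i' : Fin ℓ, ∑ k, u i k * u i' k = if i = i' then 1 else 0)
    (hv : ∀ j j' : Fin ℓ', ∑ k, v j k * v j' k = if j = j' then 1 else 0)
    (a : Fin ℓ → ℕ) (a' : Fin ℓ' → ℕ) (ha : ∑ i, a i = m) (ha' : ∑ j, a' j = m)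
    (η : Fin m → Fin ℓ) (η' : Fin m → Fin ℓ') (hη : IsEta a η) (hη' : IsEta a' η') :
    (∫ x : Fin L → ℝ,
        (∏ i, normalizedHermite (a i) (∑ k, u i k * x k)) *
          (∏ j, normalizedHermite (a' j) (∑ k, v j k * x k))
        ∂(Measure.pi fun _ : Fin L => gaussianReal 0 1)
      = (1 / Real.sqrt ((∏ i, Nat.factorial (a i)) * (∏ j, Nat.factorial (a' j)))) *
          ∑ σ : Equiv.Perm (Fin m), ∏ n : Fin m, ∑ k, u (η n) k * v (η' (σ n)) k) ∧
    (∀ (b : Fin ℓ → ℕ) (b' : Fin ℓ' → ℕ), (∑ i, b i) ≠ (∑ j, b' j) →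
      ∫ x : Fin L → ℝ,
          (∏ i, normalizedHermite (b i) (∑ k, u i k * x k)) *
            (∏ j, normalizedHermite (b' j) (∑ k, v j k * x k))
          ∂(Measure.pi fun _ : Fin L => gaussianReal 0 1)
        = 0) := by
  constructor
  · rw [integral_prod_normalizedHermite_mul u v hu hv η η' a a' (hη.card_fiber_eq ha)
      (hη'.card_fiber_eq ha'), gaussianExpectation_wickProduct_mul]
  · intro b b' hb
    obtain ⟨θ, hθ⟩ := exists_card_fiber_eq b
    obtain ⟨θ', hθ'⟩ := exists_card_fiber_eq b'
    rw [integral_prod_normalizedHermite_mul u v hu hv θ θ' b b' hθ hθ',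
      gaussianExpectation_wickProduct_mul_of_ne hb, mul_zero]
end

section
/- Let N₀, N₁ be positive integers and define c(i,j) = 1/√N₁ if (i-1)N₁ < j ≤ iN₁ and c(i,j) = 0 otherwise, for i ∈ {1,…,N₀} and j ∈ {1,…,N₀N₁}. Let a ∈ ℤ₊^{N₀} and a' ∈ ℤ₊^{N₀N₁} be multi-indices with |a| = |a'| = m. Then (1/√(a! · a'!)) · Σ_{σ ∈ S_m} Π_{n=1}^{m} c(η_a(n), η_{a'}(σ(n))) equals √(a!/a'!) · N₁^{-m/2} if a' matches a, and equals 0 otherwise. -/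
open Finset
open scoped Classical

/-- `a' ∈ ℤ₊^{N₀N₁}` matches `a ∈ ℤ₊^{N₀}` if `Σ_{k=1}^{i} a_k = Σ_{k=1}^{iN₁} a'_k`
for every `i ∈ {1,…,N₀}` (written 0-indexed). -/
def MultiIndexMatches (N₀ N₁ : ℕ) (a : Fin N₀ → ℕ) (a' : Fin (N₀ * N₁) → ℕ) : Prop :=
  ∀ i : Fin N₀,
    ∑ k ∈ Finset.univ.filter (fun k : Fin (N₀ * N₁) => (k : ℕ) < ((i : ℕ) + 1) * N₁), a' k
      = ∑ k ∈ Finset.univ.filter (fun k : Fin N₀ => k ≤ i), a k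

/-- The inner products `c(i,j) = ⟨h_i^{(N₀)}, h_j^{(N₀N₁)}⟩`: `1/√N₁` if
`(i-1)N₁ < j ≤ iN₁` (0-indexed: `iN₁ ≤ j < (i+1)N₁`) and `0` otherwise. -/
noncomputable def coarseFineInner (N₁ : ℕ) {N₀ M : ℕ} (i : Fin N₀) (j : Fin M) : ℝ :=
  if (i : ℕ) * N₁ ≤ (j : ℕ) ∧ (j : ℕ) < ((i : ℕ) + 1) * N₁ then 1 / Real.sqrt N₁ else 0

theorem IsEta.apply_eq_iff {ℓ m : ℕ} {a : Fin ℓ → ℕ} {η : Fin m → Fin ℓ} (hη : IsEta a η)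
    (n : Fin m) (i : Fin ℓ) :
    η n = i ↔ (∑ k ∈ Finset.univ.filter (fun k : Fin ℓ => k < i), a k) ≤ (n : ℕ) ∧
      (n : ℕ) < ∑ k ∈ Finset.univ.filter (fun k : Fin ℓ => k ≤ i), a k := by
  have mono : ∀ p q : Fin ℓ, p < q →
      ∑ k ∈ Finset.univ.filter (fun k : Fin ℓ => k ≤ p), a k ≤
        ∑ k ∈ Finset.univ.filter (fun k : Fin ℓ => k < q), a k := fun p q hpq =>
    Finset.sum_le_sum_of_subset fun k hk => by
      simp only [Finset.mem_filter, Finset.mem_univ, true_and] at hk ⊢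
      exact hk.trans_lt hpq
  constructor
  · rintro rfl
    exact hη n
  · rintro ⟨h₁, h₂⟩
    obtain ⟨h₃, h₄⟩ := hη n
    rcases lt_trichotomy (η n) i with h | h | h
    · have := mono _ _ h
      omega
    · exact h
    · have := mono _ _ h
      omega

theorem sum_filter_le_eq_add_sum_filter_lt {ℓ : ℕ} (a : Fin ℓ → ℕ) (i : Fin ℓ) :
    ∑ k ∈ Finset.univ.filter (fun k : Fin ℓ => k ≤ i), a k =
      a i + ∑ k ∈ Finset.univ.filter (fun k : Fin ℓ => k < i), a k := by
  have h : Finset.univ.filter (fun k : Fin ℓ => k ≤ i) =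
      insert i (Finset.univ.filter (fun k : Fin ℓ => k < i)) := by
    ext k
    simp [le_iff_eq_or_lt]
  rw [h, Finset.sum_insert (by simp)]

/-- The fibre of `η_a` over `i` has `a i` elements. -/
theorem IsEta.card_fiber {ℓ m : ℕ} {a : Fin ℓ → ℕ} {η : Fin m → Fin ℓ} (hη : IsEta a η)
    (ha : ∑ i, a i = m) (i : Fin ℓ) :
    (Finset.univ.filter (fun n => η n = i)).card = a i := by
  have hle : ∑ k ∈ Finset.univ.filter (fun k : Fin ℓ => k ≤ i), a k ≤ m :=
    ha ▸ Finset.sum_le_sum_of_subset (Finset.filter_subset _ _)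
  have hmap : (Finset.univ.filter (fun n => η n = i)).map Fin.valEmbedding =
      Finset.Ico (∑ k ∈ Finset.univ.filter (fun k : Fin ℓ => k < i), a k)
        (∑ k ∈ Finset.univ.filter (fun k : Fin ℓ => k ≤ i), a k) := by
    ext x
    simp only [Finset.mem_map, Finset.mem_filter, Finset.mem_univ, true_and, hη.apply_eq_iff,
      Fin.valEmbedding_apply, Finset.mem_Ico]
    constructor
    · rintro ⟨n, hn, rfl⟩
      exact hn
    · intro hx
      exact ⟨⟨x, by omega⟩, hx, rfl⟩
  rw [← Finset.card_map, hmap, Nat.card_Ico, sum_filter_le_eq_add_sum_filter_lt]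
  omega

/-- Two multi-indices with the same partial sums coincide. -/
theorem forall_sum_filter_le_eq_iff {ℓ : ℕ} (a b : Fin ℓ → ℕ) :
    (∀ i, ∑ k ∈ Finset.univ.filter (fun k : Fin ℓ => k ≤ i), b k =
      ∑ k ∈ Finset.univ.filter (fun k : Fin ℓ => k ≤ i), a k) ↔ ∀ i, b i = a i := by
  constructor
  · intro h i
    induction i using WellFoundedLT.induction with
    | ind i ih =>
      have hi := h i
      rw [sum_filter_le_eq_add_sum_filter_lt, sum_filter_le_eq_add_sum_filter_lt,
        Finset.sum_congr rfl fun k hk => ih k (Finset.mem_filter.1 hk).2] at hi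
      exact Nat.add_right_cancel hi
  · exact fun h i => Finset.sum_congr rfl fun k _ => h k

theorem multiIndexMatches_iff {N₀ N₁ : ℕ} (hN₁ : 0 < N₁) (a : Fin N₀ → ℕ)
    (a' : Fin (N₀ * N₁) → ℕ) :
    MultiIndexMatches N₀ N₁ a a' ↔
      ∀ i, ∑ j ∈ Finset.univ.filter (fun j : Fin (N₀ * N₁) => j.divNat = i), a' j = a i := by
  rw [← forall_sum_filter_le_eq_iff]
  refine forall_congr' fun i => ?_
  rw [Finset.sum_fiberwise_eq_sum_filter]
  have h : ∀ k : Fin (N₀ * N₁), (k : ℕ) < ((i : ℕ) + 1) * N₁ ↔ k.divNat ≤ i := fun k => by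
    rw [Fin.le_def, Fin.coe_divNat, ← Nat.lt_succ_iff, Nat.div_lt_iff_lt_mul hN₁]
  simp [h]

theorem coarseFineInner_eq_ite {N₀ N₁ : ℕ} (hN₁ : 0 < N₁) (i : Fin N₀) (j : Fin (N₀ * N₁)) :
    coarseFineInner N₁ i j = if j.divNat = i then 1 / Real.sqrt N₁ else 0 := by
  unfold coarseFineInner
  congr 1
  rw [Fin.ext_iff, Fin.coe_divNat, eq_iff_iff, le_antisymm_iff, Nat.le_div_iff_mul_le hN₁,
    ← Nat.lt_succ_iff (n := (i : ℕ)), Nat.div_lt_iff_lt_mul hN₁, and_comm]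

theorem IsEta.card_fiber_divNat {N₀ N₁ m : ℕ} {a' : Fin (N₀ * N₁) → ℕ}
    {η' : Fin m → Fin (N₀ * N₁)} (hη' : IsEta a' η') (ha' : ∑ j, a' j = m) (i : Fin N₀) :
    (Finset.univ.filter (fun n => (η' n).divNat = i)).card =
      ∑ j ∈ Finset.univ.filter (fun j : Fin (N₀ * N₁) => j.divNat = i), a' j := by
  rw [Finset.card_eq_sum_card_fiberwise (f := η')
    (t := Finset.univ.filter (fun j : Fin (N₀ * N₁) => j.divNat = i))
    (fun n hn => by simpa using hn)]
  refine Finset.sum_congr rfl fun j hj => ?_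
  rw [← hη'.card_fiber ha' j, Finset.filter_filter]
  congr 1
  ext n
  simp only [Finset.mem_filter, Finset.mem_univ, true_and] at hj ⊢
  exact ⟨fun h => h.2, fun h => ⟨h ▸ hj, h⟩⟩

/-- The number of permutations carrying `f` to `g` is the product of the factorials of the fibre
cardinalities of `f` if these agree with those of `g`, and `0` otherwise. -/
theorem card_perm_comp_eq {α ι : Type*} [Fintype α] [DecidableEq α] [Fintype ι]
    [DecidableEq ι] (f g : α → ι) :
    (Finset.univ.filter (fun σ : Equiv.Perm α => ∀ n, g (σ n) = f n)).card =
      if ∀ i, (Finset.univ.filter (fun n => g n = i)).card =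
          (Finset.univ.filter (fun n => f n = i)).card then
        ∏ i, ((Finset.univ.filter (fun n => f n = i)).card).factorial
      else 0 := by
  split_ifs with h
  · have e : ∀ i, {n // f n = i} ≃ {n // g n = i} := fun i =>
      Fintype.equivOfCardEq (by rw [Fintype.card_subtype, Fintype.card_subtype, h i])
    have hτ : ∀ n, g (Equiv.ofFiberEquiv e n) = f n := Equiv.ofFiberEquiv_map e
    set τ : Equiv.Perm α := Equiv.ofFiberEquiv e
    have hcard := DomMulAct.stabilizer_card f
    simp only [Fintype.card_subtype] at hcard
    rw [← hcard]
    refine Finset.card_equiv (Equiv.mulLeft τ⁻¹) fun σ => ?_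
    simp only [Finset.mem_filter, Finset.mem_univ, true_and, Equiv.coe_mulLeft, funext_iff,
      Function.comp_apply, Equiv.Perm.mul_apply, ← hτ, Equiv.Perm.inv_def, Equiv.apply_symm_apply]
  · rw [Finset.card_eq_zero, Finset.filter_eq_empty_iff]
    intro σ _ hσ
    refine h fun i => (Finset.card_equiv σ fun n => ?_).symm
    simp [hσ]

/-- Lemma 4.5 of the paper in combinatorial form: for `|a| = |a'| = m`,
`(1/√(a!·a'!)) Σ_{σ ∈ S_m} Π_n c(η_a(n), η_{a'}(σ(n)))` equals `√(a!/a'!)·N₁^{-m/2}` if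
`a'` matches `a` and `0` otherwise. -/
theorem hilbertSchmidt_inner_coarse_fine (N₀ N₁ m : ℕ) (hN₀ : 0 < N₀) (hN₁ : 0 < N₁)
    (a : Fin N₀ → ℕ) (a' : Fin (N₀ * N₁) → ℕ)
    (ha : ∑ i, a i = m) (ha' : ∑ j, a' j = m)
    (η : Fin m → Fin N₀) (η' : Fin m → Fin (N₀ * N₁))
    (hη : IsEta a η) (hη' : IsEta a' η') :
    (1 / Real.sqrt ((∏ i, Nat.factorial (a i)) * (∏ j, Nat.factorial (a' j)))) *
        ∑ σ : Equiv.Perm (Fin m), ∏ n : Fin m, coarseFineInner N₁ (η n) (η' (σ n))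
      = if MultiIndexMatches N₀ N₁ a a' then
          Real.sqrt ((∏ i, Nat.factorial (a i) : ℕ) / (∏ j, Nat.factorial (a' j) : ℕ) : ℝ) *
            ((N₁ : ℝ) ^ (-(m : ℝ) / 2))
        else 0 := by
  have hsum : ∑ σ : Equiv.Perm (Fin m), ∏ n : Fin m, coarseFineInner N₁ (η n) (η' (σ n)) =
      (if MultiIndexMatches N₀ N₁ a a' then ((∏ i, Nat.factorial (a i) : ℕ) : ℝ) else 0) *
        (1 / Real.sqrt N₁) ^ m := by
    have hprod : ∀ σ : Equiv.Perm (Fin m),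
        ∏ n : Fin m, coarseFineInner N₁ (η n) (η' (σ n)) =
          if ∀ n, (η' (σ n)).divNat = η n then (1 / Real.sqrt N₁) ^ m else 0 := fun σ => by
      simp only [coarseFineInner_eq_ite hN₁, Finset.prod_ite_zero, Finset.mem_univ, true_implies,
        Finset.prod_const, Finset.card_univ, Fintype.card_fin]
    have hcard : (Finset.univ.filter
        (fun σ : Equiv.Perm (Fin m) => ∀ n, (η' (σ n)).divNat = η n)).card =
          if MultiIndexMatches N₀ N₁ a a' then ∏ i, Nat.factorial (a i) else 0 := by
      have h := card_perm_comp_eq η (fun n => (η' n).divNat)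
      simp only [hη.card_fiber ha, hη'.card_fiber_divNat ha', ← multiIndexMatches_iff hN₁] at h
      convert h
    simp only [hprod]
    rw [← Finset.sum_filter, Finset.sum_const, hcard, nsmul_eq_mul]
    split_ifs <;> simp
  rw [hsum]
  split_ifs
  · have hpow : (1 / Real.sqrt N₁) ^ m = (N₁ : ℝ) ^ (-(m : ℝ) / 2) := by
      rw [Real.sqrt_eq_rpow, one_div, ← Real.rpow_neg (Nat.cast_nonneg _), ← Real.rpow_natCast,
        ← Real.rpow_mul (Nat.cast_nonneg _)]
      congr 1
      ring
    have hA : (0 : ℝ) < ((∏ i, Nat.factorial (a i) : ℕ) : ℝ) :=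
      Nat.cast_pos.2 (Finset.prod_pos fun i _ => Nat.factorial_pos _)
    rw [hpow, ← mul_assoc, Real.sqrt_mul hA.le, Real.sqrt_div hA.le]
    congr 1
    rw [one_div, mul_inv, mul_right_comm, ← div_eq_inv_mul, Real.div_sqrt, div_eq_mul_inv]
  · simp
end

section
/- Let N₀, N₁, n be positive integers, r ∈ [0,1], and let a ∈ ℤ₊^{N₀} be a multi-index. Then Σ_{a'} (a! / a'!) · N₁^{-|a|} ≤ ( |a|^n / (n! · N₁^n) )^r, where the sum is over all multi-indices a' ∈ ℤ₊^{N₀N₁} that match a and for which there exists ℓ' ∈ ℕ with a'_{ℓ'} > n and a'_i = 0 for all i > ℓ'. -/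
open Finset

/-- The last nonzero entry of `a'` exceeds `n`: there is `ℓ'` with `a'_{ℓ'} > n` and
`a'_i = 0` for all `i > ℓ'`. -/
def LastEntryExceeds (M n : ℕ) (a' : Fin M → ℕ) : Prop :=
  ∃ ℓ' : Fin M, a' ℓ' > n ∧ ∀ i : Fin M, ℓ' < i → a' i = 0

/-- Two functions on `Fin N` with the same initial sums are equal. -/
lemma eq_of_sum_filter_le_eq {N : ℕ} {u v : Fin N → ℕ}
    (h : ∀ i, ∑ k ∈ univ.filter (fun k => k ≤ i), u k = ∑ k ∈ univ.filter (fun k => k ≤ i), v k)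
    (i : Fin N) : u i = v i := by
  induction i using WellFoundedLT.induction with
  | ind i ih =>
    have hs : univ.filter (fun k : Fin N => k ≤ i) = insert i (univ.filter (fun k => k < i)) := by
      ext k
      simp [le_iff_eq_or_lt]
    have hi := h i
    rw [hs, sum_insert (by simp), sum_insert (by simp),
      sum_congr rfl fun k hk => ih k (by simpa using hk)] at hi
    exact Nat.add_right_cancel hi

lemma MultiIndexMatches.sum_block {N₀ N₁ : ℕ} {a : Fin N₀ → ℕ} {a' : Fin (N₀ * N₁) → ℕ}
    (h : MultiIndexMatches N₀ N₁ a a') (i : Fin N₀) :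
    ∑ j, a' (finProdFinEquiv (i, j)) = a i := by
  refine eq_of_sum_filter_le_eq (u := fun i => ∑ j, a' (finProdFinEquiv (i, j))) (fun i => ?_) i
  rw [← h i, sum_filter, sum_filter, ← finProdFinEquiv.sum_comp, Fintype.sum_prod_type]
  refine sum_congr rfl fun k _ => ?_
  have hlt (j : Fin N₁) : ((finProdFinEquiv (k, j) : Fin (N₀ * N₁)) : ℕ) < ((i : ℕ) + 1) * N₁ ↔
      k ≤ i := by
    have hj := j.isLt
    rw [finProdFinEquiv_apply_val, Fin.le_def]
    constructor
    · intro hk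
      by_contra! hik
      nlinarith
    · intro hk
      nlinarith
  simp only [hlt]
  split_ifs <;> simp

lemma sum_piAntidiag_factorial_div (N m : ℕ) :
    ∑ g ∈ piAntidiag (univ : Finset (Fin N)) m,
      (m.factorial : ℝ) / ((∏ j, (g j).factorial : ℕ) : ℝ) = (N : ℝ) ^ m := by
  have h := sum_pow_eq_sum_piAntidiag (univ : Finset (Fin N)) (fun _ => (1 : ℝ)) m
  simp only [sum_const, card_univ, Fintype.card_fin, nsmul_eq_mul, mul_one, one_pow,
    prod_const_one] at h
  rw [h]
  refine sum_congr rfl fun g hg => ?_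
  have hs := Nat.multinomial_spec (univ : Finset (Fin N)) g
  rw [(mem_piAntidiag.1 hg).1] at hs
  have hne : ((∏ j, (g j).factorial : ℕ) : ℝ) ≠ 0 :=
    Nat.cast_ne_zero.2 (prod_ne_zero_iff.2 fun j _ => Nat.factorial_ne_zero _)
  rw [div_eq_iff hne, ← hs]
  push_cast
  ring

lemma tsum_le_sum_of_injective {ι β : Type*} {s : Finset β} {f : ι → ℝ} {g : β → ℝ} {φ : ι → β}
    (hφ : Function.Injective φ) (hmem : ∀ i, φ i ∈ s) (hle : ∀ i, f i ≤ g (φ i))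
    (hg : ∀ b ∈ s, 0 ≤ g b) : ∑' i, f i ≤ ∑ b ∈ s, g b := by
  classical
  have : Finite ι := Finite.of_injective (fun i => (⟨φ i, hmem i⟩ : s)) fun i j hij =>
    hφ (congrArg Subtype.val hij)
  have := Fintype.ofFinite ι
  rw [tsum_fintype]
  calc ∑ i, f i ≤ ∑ i, g (φ i) := sum_le_sum fun i _ => hle i
    _ = ∑ b ∈ univ.image φ, g b := (sum_image fun i _ j _ hij => hφ hij).symm
    _ ≤ ∑ b ∈ s, g b := sum_le_sum_of_subset_of_nonneg
        (image_subset_iff.2 fun i _ => hmem i) fun b hb _ => hg b hb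

/-- Blockwise multinomial theorem, as an upper bound for families of multi-indices with
prescribed block sums `c`. -/
lemma tsum_le_mul_pow_of_sum_block {N₀ N₁ : ℕ} {ι : Type*} {f : ι → ℝ} {K : ℝ} (hK : 0 ≤ K)
    (c : Fin N₀ → ℕ) {φ : ι → Fin (N₀ * N₁) → ℕ} (hφ : Function.Injective φ)
    (hsum : ∀ s i, ∑ j, φ s (finProdFinEquiv (i, j)) = c i)
    (hle : ∀ s, f s ≤ K * (((∏ i, (c i).factorial : ℕ) : ℝ) /
      ((∏ j, (φ s j).factorial : ℕ) : ℝ))) :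
    ∑' s, f s ≤ K * (N₁ : ℝ) ^ (∑ i, c i) := by
  have htotal : ∑ g ∈ Fintype.piFinset fun i => piAntidiag (univ : Finset (Fin N₁)) (c i),
      K * ∏ i, (((c i).factorial : ℝ) / ((∏ j, (g i j).factorial : ℕ) : ℝ)) =
      K * (N₁ : ℝ) ^ (∑ i, c i) := by
    rw [← mul_sum, ← prod_univ_sum (fun i => piAntidiag (univ : Finset (Fin N₁)) (c i))
      fun i g => ((c i).factorial : ℝ) / ((∏ j, (g j).factorial : ℕ) : ℝ)]
    simp only [sum_piAntidiag_factorial_div, prod_pow_eq_pow_sum]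
  rw [← htotal]
  refine tsum_le_sum_of_injective (φ := fun s i j => φ s (finProdFinEquiv (i, j)))
    (fun s t hst => hφ (funext fun k => ?_)) (fun s => ?_) (fun s => ?_) fun g _ => ?_
  · obtain ⟨⟨i, j⟩, rfl⟩ := finProdFinEquiv.surjective k
    exact congrFun (congrFun hst i) j
  · simp [Fintype.mem_piFinset, mem_piAntidiag, hsum]
  · refine (hle s).trans_eq ?_
    rw [prod_div_distrib, ← finProdFinEquiv.prod_comp, Fintype.prod_prod_type]
    push_cast
    rfl
  · positivity

lemma prod_factorial_eq_choose_mul {ι : Type*} [Fintype ι] [DecidableEq ι] (f : ι → ℕ) {i : ι}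
    {n : ℕ} (h : n ≤ f i) :
    ∏ j, (f j).factorial =
      (f i).choose n * n.factorial * ∏ j, (Function.update f i (f i - n) j).factorial := by
  rw [← mul_prod_erase univ _ (mem_univ i),
    ← mul_prod_erase univ (fun j => (Function.update f i (f i - n) j).factorial) (mem_univ i),
    Function.update_self, ← mul_assoc, Nat.choose_mul_factorial_mul_factorial h]
  congr 1
  refine prod_congr rfl fun j hj => ?_
  rw [Function.update_of_ne (ne_of_mem_erase hj)]

lemma prod_factorial_div_le {ι κ : Type*} [Fintype ι] [DecidableEq ι] [Fintype κ] [DecidableEq κ]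
    (f : ι → ℕ) (g : κ → ℕ) {i : ι} {k : κ} {n : ℕ} (hf : n ≤ f i) (hg : n ≤ g k) :
    ((∏ j, (f j).factorial : ℕ) : ℝ) / ((∏ j, (g j).factorial : ℕ) : ℝ) ≤
      ((f i).choose n : ℝ) *
        (((∏ j, (Function.update f i (f i - n) j).factorial : ℕ) : ℝ) /
          ((∏ j, (Function.update g k (g k - n) j).factorial : ℕ) : ℝ)) := by
  rw [prod_factorial_eq_choose_mul f hf, prod_factorial_eq_choose_mul g hg]
  set P := ∏ j, (Function.update f i (f i - n) j).factorial
  have hQ : 0 < ∏ j, (Function.update g k (g k - n) j).factorial :=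
    prod_pos fun j _ => Nat.factorial_pos _
  set Q := ∏ j, (Function.update g k (g k - n) j).factorial
  have hQ' : (0 : ℝ) < Q := by exact_mod_cast hQ
  have hn : (0 : ℝ) < n.factorial := by exact_mod_cast n.factorial_pos
  have hc : (1 : ℝ) ≤ (g k).choose n := by exact_mod_cast Nat.choose_pos hg
  push_cast
  rw [← mul_div_assoc]
  calc ((f i).choose n * n.factorial * P : ℝ) / ((g k).choose n * n.factorial * Q)
      ≤ ((f i).choose n * n.factorial * P) / (1 * n.factorial * Q) := by gcongr
    _ = (f i).choose n * P / Q := by field_simp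

lemma le_rpow_of_le_one_of_le {S X r : ℝ} (hX : 0 ≤ X) (hr0 : 0 ≤ r) (hr1 : r ≤ 1)
    (h1 : S ≤ 1) (hSX : S ≤ X) : S ≤ X ^ r := by
  rcases le_total 1 X with h | h
  · exact h1.trans (Real.one_le_rpow h hr0)
  · exact hSX.trans (Real.self_le_rpow_of_le_one hX h hr1)

/-- Lowering the last nonzero entry by `n`, when it exceeds `n`, is injective. -/
lemma eq_of_update_last_sub_eq {M n : ℕ} {f g : Fin M → ℕ} {k l : Fin M}
    (hf : n < f k) (hf0 : ∀ i, k < i → f i = 0) (hg : n < g l) (hg0 : ∀ i, l < i → g i = 0)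
    (h : Function.update f k (f k - n) = Function.update g l (g l - n)) : f = g := by
  have hkl : k = l := by
    rcases lt_trichotomy k l with hlt | heq | hlt
    · have := congrFun h l
      rw [Function.update_of_ne hlt.ne', Function.update_self, hf0 l hlt] at this
      omega
    · exact heq
    · have := congrFun h k
      rw [Function.update_of_ne hlt.ne', Function.update_self, hg0 k hlt] at this
      omega
  subst hkl
  funext i
  have hi := congrFun h i
  by_cases hik : i = k
  · subst hik
    rw [Function.update_self, Function.update_self] at hi
    omega
  · rwa [Function.update_of_ne hik, Function.update_of_ne hik] at hi

/-- The block containing the last nonzero entry of `a'` is the last nonzero block of `a`. -/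
lemma MultiIndexMatches.eq_zero_of_block_lt {N₀ N₁ : ℕ} {a : Fin N₀ → ℕ}
    {a' : Fin (N₀ * N₁) → ℕ} (h : MultiIndexMatches N₀ N₁ a a') {i k : Fin N₀} {j : Fin N₁}
    (h0 : ∀ l, finProdFinEquiv (i, j) < l → a' l = 0) (hik : i < k) : a k = 0 := by
  rw [← h.sum_block k]
  refine sum_eq_zero fun j' _ => h0 _ ?_
  have hj := j.isLt
  rw [Fin.lt_def, finProdFinEquiv_apply_val, finProdFinEquiv_apply_val]
  rw [Fin.lt_def] at hik
  nlinarith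

lemma MultiIndexMatches.le_block {N₀ N₁ : ℕ} {a : Fin N₀ → ℕ} {a' : Fin (N₀ * N₁) → ℕ}
    (h : MultiIndexMatches N₀ N₁ a a') (i : Fin N₀) (j : Fin N₁) :
    a' (finProdFinEquiv (i, j)) ≤ a i := by
  rw [← h.sum_block i]
  exact single_le_sum (f := fun j => a' (finProdFinEquiv (i, j))) (fun _ _ => Nat.zero_le _)
    (mem_univ j)

lemma MultiIndexMatches.sum_block_update {N₀ N₁ n : ℕ} {a : Fin N₀ → ℕ}
    {a' : Fin (N₀ * N₁) → ℕ} (h : MultiIndexMatches N₀ N₁ a a') {i : Fin N₀} {j : Fin N₁}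
    (hn : n ≤ a' (finProdFinEquiv (i, j))) (k : Fin N₀) :
    ∑ j', Function.update a' (finProdFinEquiv (i, j)) (a' (finProdFinEquiv (i, j)) - n)
      (finProdFinEquiv (k, j')) = Function.update a i (a i - n) k := by
  by_cases hki : k = i
  · subst hki
    rw [Function.update_self, ← h.sum_block k, ← add_sum_erase univ _ (mem_univ j),
      ← add_sum_erase univ (fun j' => a' (finProdFinEquiv (k, j'))) (mem_univ j),
      Function.update_self]
    have herase : ∑ j' ∈ univ.erase j, Function.update a' (finProdFinEquiv (k, j))
        (a' (finProdFinEquiv (k, j)) - n) (finProdFinEquiv (k, j')) =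
        ∑ j' ∈ univ.erase j, a' (finProdFinEquiv (k, j')) :=
      sum_congr rfl fun j' hj' => Function.update_of_ne
        (by simpa using ne_of_mem_erase hj') _ _
    omega
  · rw [Function.update_of_ne hki, ← h.sum_block k]
    refine sum_congr rfl fun j' _ => Function.update_of_ne ?_ _ _
    simp [hki]

lemma tsum_matching_le_pow {N₀ N₁ : ℕ} (n : ℕ) (a : Fin N₀ → ℕ) :
    ∑' a' : {a' : Fin (N₀ * N₁) → ℕ //
        MultiIndexMatches N₀ N₁ a a' ∧ LastEntryExceeds (N₀ * N₁) n a'},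
      ((∏ i, (a i).factorial : ℕ) : ℝ) / ((∏ j, (a'.1 j).factorial : ℕ) : ℝ) ≤
      (N₁ : ℝ) ^ (∑ i, a i) := by
  have h := tsum_le_mul_pow_of_sum_block (N₁ := N₁) zero_le_one a Subtype.val_injective
    (fun s => s.2.1.sum_block) fun (s : {a' : Fin (N₀ * N₁) → ℕ //
      MultiIndexMatches N₀ N₁ a a' ∧ LastEntryExceeds (N₀ * N₁) n a'}) => (one_mul _).ge
  rwa [one_mul] at h

lemma tsum_matching_mul_pow_le {N₀ N₁ : ℕ} (n : ℕ) (a : Fin N₀ → ℕ) :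
    (∑' a' : {a' : Fin (N₀ * N₁) → ℕ //
        MultiIndexMatches N₀ N₁ a a' ∧ LastEntryExceeds (N₀ * N₁) n a'},
      ((∏ i, (a i).factorial : ℕ) : ℝ) / ((∏ j, (a'.1 j).factorial : ℕ) : ℝ)) * (N₁ : ℝ) ^ n ≤
      ((∑ i, a i : ℕ) : ℝ) ^ n / n.factorial * (N₁ : ℝ) ^ (∑ i, a i) := by
  rcases isEmpty_or_nonempty {a' : Fin (N₀ * N₁) → ℕ //
      MultiIndexMatches N₀ N₁ a a' ∧ LastEntryExceeds (N₀ * N₁) n a'} with hE | ⟨⟨b, hb, hbn⟩⟩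
  · rw [tsum_empty, zero_mul]
    positivity
  have key (s : {a' : Fin (N₀ * N₁) → ℕ //
      MultiIndexMatches N₀ N₁ a a' ∧ LastEntryExceeds (N₀ * N₁) n a'}) :
      ∃ p : Fin N₀ × Fin N₁, n < s.1 (finProdFinEquiv p) ∧
        ∀ l, finProdFinEquiv p < l → s.1 l = 0 := by
    obtain ⟨l, hl⟩ := s.2.2
    exact ⟨finProdFinEquiv.symm l, by simpa only [Equiv.apply_symm_apply] using hl⟩
  obtain ⟨⟨i₀, j₀⟩, hp, hp0⟩ := key ⟨b, hb, hbn⟩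
  have hi₀ : n < a i₀ := hp.trans_le (hb.le_block i₀ j₀)
  have key' (s : {a' : Fin (N₀ * N₁) → ℕ //
      MultiIndexMatches N₀ N₁ a a' ∧ LastEntryExceeds (N₀ * N₁) n a'}) :
      ∃ j : Fin N₁, n < s.1 (finProdFinEquiv (i₀, j)) ∧
        ∀ l, finProdFinEquiv (i₀, j) < l → s.1 l = 0 := by
    obtain ⟨⟨i, j⟩, hs, hs0⟩ := key s
    have hi : n < a i := hs.trans_le (s.2.1.le_block i j)
    obtain rfl : i = i₀ := by
      rcases lt_trichotomy i i₀ with hlt | heq | hlt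
      · have := s.2.1.eq_zero_of_block_lt hs0 hlt
        omega
      · exact heq
      · have := hb.eq_zero_of_block_lt hp0 hlt
        omega
    exact ⟨j, hs, hs0⟩
  choose j hj hj0 using key'
  have hsum : ∑ i, a i = (∑ i, Function.update a i₀ (a i₀ - n) i) + n := by
    rw [← add_sum_erase univ a (mem_univ i₀), ← add_sum_erase univ _ (mem_univ i₀),
      Function.update_self, sum_congr rfl fun k hk => Function.update_of_ne
        (ne_of_mem_erase hk) _ _]
    omega
  have hle := tsum_le_mul_pow_of_sum_block (Nat.cast_nonneg ((a i₀).choose n))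
    (Function.update a i₀ (a i₀ - n))
    (fun s t hst => Subtype.ext (eq_of_update_last_sub_eq (hj s) (hj0 s) (hj t) (hj0 t) hst))
    (fun s => s.2.1.sum_block_update (hj s).le)
    (fun s => prod_factorial_div_le a s.1 hi₀.le (hj s).le)
  calc _ ≤ (a i₀).choose n * (N₁ : ℝ) ^ (∑ i, Function.update a i₀ (a i₀ - n) i) *
        (N₁ : ℝ) ^ n := by gcongr
    _ = (a i₀).choose n * (N₁ : ℝ) ^ (∑ i, a i) := by rw [hsum, pow_add, mul_assoc]
    _ ≤ (a i₀ : ℝ) ^ n / n.factorial * (N₁ : ℝ) ^ (∑ i, a i) := by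
        gcongr
        exact Nat.choose_le_pow_div n (a i₀)
    _ ≤ _ := by
        gcongr
        exact single_le_sum (fun _ _ => Nat.zero_le _) (mem_univ i₀)

/-- For `r ∈ [0,1]`,
`Σ (a!/a'!) · N₁^{-|a|} ≤ (|a|^n / (n! N₁^n))^r`, the sum being over all `a'` matching `a`
whose last nonzero entry exceeds `n` (Lemma 4.6(3)). -/
theorem sum_matching_tail_le_rpow (N₀ N₁ n : ℕ) (hN₀ : 0 < N₀) (hN₁ : 0 < N₁) (hn : 0 < n)
    (r : ℝ) (hr0 : 0 ≤ r) (hr1 : r ≤ 1) (a : Fin N₀ → ℕ) :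
    ∑' a' : {a' : Fin (N₀ * N₁) → ℕ //
        MultiIndexMatches N₀ N₁ a a' ∧ LastEntryExceeds (N₀ * N₁) n a'},
      ((∏ i, Nat.factorial (a i) : ℕ) : ℝ) /
          ((∏ j, Nat.factorial ((a' : Fin (N₀ * N₁) → ℕ) j) : ℕ) : ℝ) *
        ((N₁ : ℝ) ^ (∑ i, a i))⁻¹
      ≤ (((∑ i, a i : ℕ) : ℝ) ^ n / (Nat.factorial n * (N₁ : ℝ) ^ n)) ^ r := by
  have hN : (0 : ℝ) < N₁ := by exact_mod_cast hN₁
  rw [tsum_mul_right]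
  refine le_rpow_of_le_one_of_le (by positivity) hr0 hr1 ?_ ?_
  · rw [← div_eq_mul_inv, div_le_one (by positivity)]
    exact tsum_matching_le_pow n a
  · rw [← div_eq_mul_inv, ← div_div, div_le_div_iff₀ (by positivity) (by positivity)]
    exact tsum_matching_mul_pow_le n a
end
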